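/- arXiv:1509.01716 — 4 statements merged into one kernel-verified Lean document; each statement's English description precedes it below -/
import Mathlib

section
/- Let a < b be real numbers and n ≥ 1 a natural number. Let μ₁, μ₂ be finite signed measures on ℝ concentrated on (a,b], with distribution functions F₁(x) = μ₁((a,x]), F₂(x) = μ₂((a,x]); define H₀ = F₂ − F₁ and H_k(x) = ∫_a^x H_{k−1}(t) dt for k = 1, …, n. Assume H_k(b) = 0 for all k = 0, 1, …, n. Suppose there are points a = x₀ < x₁ < ⋯ < x_m < x_{m+1} = b with m EVEN such that the function H_{n−1} changes sign exactly at x₁, …, x_m with (−1)^{n+1} H_{n−1} ≥ 0 on (a, x₁), i.e., for each i = 0, 1, …, m, (−1)^{n+1+i} H_{n−1}(x) ≥ 0 for all x ∈ (x_i, x_{i+1}) and H_{n−1} is not identically zero on (x_i, x_{i+1}). Then there exists a continuous n-convex function f : [a,b] → ℝ with ∫_{[a,b]} f dμ₁ > ∫_{[a,b]} f dμ₂. -/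
open MeasureTheory Set

/-- Integral of `f` with respect to a finite signed measure `μ`,
defined via the Jordan decomposition `μ = μ⁺ - μ⁻`. -/
noncomputable def sintegral (μ : SignedMeasure ℝ) (f : ℝ → ℝ) : ℝ :=
  (∫ x, f x ∂μ.toJordanDecomposition.posPart) - ∫ x, f x ∂μ.toJordanDecomposition.negPart

/-- Integral of `f` over a set `s` with respect to a finite signed measure `μ`. -/
noncomputable def sintegralOn (μ : SignedMeasure ℝ) (s : Set ℝ) (f : ℝ → ℝ) : ℝ :=
  (∫ x in s, f x ∂μ.toJordanDecomposition.posPart) - ∫ x in s, f x ∂μ.toJordanDecomposition.negPart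

/-- A signed measure `μ` is concentrated on `s` if `|μ|(sᶜ) = 0`. -/
def ConcentratedOn (μ : SignedMeasure ℝ) (s : Set ℝ) : Prop :=
  μ.totalVariation sᶜ = 0

/-- Iterated integrals based at `a`: `I₀ = F`, `I_{k+1}(x) = ∫_a^x I_k(t) dt`. -/
noncomputable def iterInt (a : ℝ) (F : ℝ → ℝ) : ℕ → ℝ → ℝ
  | 0 => F
  | k + 1 => fun x => ∫ t in a..x, iterInt a F k t

/-- `f` is `n`-convex on `(a,b)` (`n ≥ 1`): it is `(n-1)`-times differentiable on `(a,b)`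
and its `(n-1)`-st derivative is convex on `(a,b)`. -/
def NConvexOn (n : ℕ) (a b : ℝ) (f : ℝ → ℝ) : Prop :=
  ContDiffOn ℝ ((n - 1 : ℕ) : ℕ∞) f (Ioo a b) ∧
  ConvexOn ℝ (Ioo a b) (iteratedDerivWithin (n - 1) f (Ioo a b))

/-- The normalized truncated power `(s - t)₊ᵏ / k!`, equal to the indicator of `t ≤ s` for `k = 0`. -/
noncomputable def truncPow (k : ℕ) (s t : ℝ) : ℝ :=
  if t ≤ s then (s - t) ^ k / (k.factorial : ℝ) else 0

theorem measurable_uncurry_truncPow (k : ℕ) :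
    Measurable (Function.uncurry (truncPow k)) := by
  unfold truncPow Function.uncurry
  exact Measurable.ite (measurableSet_le measurable_snd measurable_fst) (by fun_prop) measurable_const

theorem measurable_truncPow (k : ℕ) (s : ℝ) : Measurable (truncPow k s) :=
  (measurable_uncurry_truncPow k).comp measurable_prodMk_left

theorem norm_truncPow_le {a b s t : ℝ} (k : ℕ) (hs : s ≤ b) (ht : a ≤ t) :
    ‖truncPow k s t‖ ≤ |b - a| ^ k := by
  unfold truncPow
  split_ifs with h
  · have h1 : (1 : ℝ) ≤ k.factorial := by exact_mod_cast Nat.one_le_iff_ne_zero.2 k.factorial_ne_zero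
    rw [Real.norm_eq_abs, abs_div, abs_pow, abs_of_nonneg (by linarith : 0 ≤ s - t),
      abs_of_nonneg (by linarith : (0 : ℝ) ≤ k.factorial),
      abs_of_nonneg (by linarith : 0 ≤ b - a)]
    calc (s - t) ^ k / (k.factorial : ℝ) ≤ (s - t) ^ k :=
          div_le_self (pow_nonneg (by linarith) _) h1
      _ ≤ (b - a) ^ k := pow_le_pow_left₀ (by linarith) (by linarith) _
  · simp

theorem integral_truncPow {a s t : ℝ} (k : ℕ) (hat : a ≤ t) (has : a ≤ s) :
    ∫ r in a..s, truncPow k r t = truncPow (k + 1) s t := by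
  by_cases hts : t ≤ s
  · have hint : ∀ u v : ℝ, IntervalIntegrable (fun r => truncPow k r t) volume u v := by
      intro u v
      have hle : ∀ r ∈ Set.uIoc u v, ‖truncPow k r t‖ ≤ |max u v - t| ^ k :=
        fun r hr => norm_truncPow_le k hr.2 le_rfl
      refine (intervalIntegrable_const (c := |max u v - t| ^ k)).mono_fun' ?_ ?_
      · exact ((measurable_uncurry_truncPow k).comp measurable_prodMk_right).aestronglyMeasurable
      · exact (ae_restrict_mem measurableSet_uIoc).mono hle
    rw [← intervalIntegral.integral_add_adjacent_intervals (hint a t) (hint t s)]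
    have h1 : ∫ r in a..t, truncPow k r t = 0 := by
      refine intervalIntegral.integral_zero_ae ?_
      filter_upwards [compl_mem_ae_iff.2 (measure_singleton t)] with r hr hmem
      rw [uIoc_of_le hat] at hmem
      exact if_neg fun h => hr (le_antisymm hmem.2 h)
    have h2 : ∫ r in t..s, truncPow k r t
        = ∫ r in t..s, (r - t) ^ k / (k.factorial : ℝ) := by
      refine intervalIntegral.integral_congr fun r hr => ?_
      rw [uIcc_of_le hts] at hr
      exact if_pos hr.1
    rw [h1, h2, zero_add, intervalIntegral.integral_div,
      intervalIntegral.integral_comp_sub_right (fun r => r ^ k), integral_pow]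
    simp only [truncPow, if_pos hts, Nat.factorial_succ]
    push_cast
    field_simp
    simp
  · rw [truncPow, if_neg hts]
    refine intervalIntegral.integral_zero_ae (Filter.Eventually.of_forall fun r hr => ?_)
    rw [uIoc_of_le has] at hr
    exact if_neg fun h => hts (h.trans hr.2)

/-- The integral against `ν` of the truncated power based at `s`. -/
noncomputable def truncMoment (ν : Measure ℝ) (k : ℕ) (s : ℝ) : ℝ :=
  ∫ t, truncPow k s t ∂ν

theorem truncMoment_zero (ν : Measure ℝ) (s : ℝ) : truncMoment ν 0 s = ν.real (Iic s) := by
  have : truncPow 0 s = (Iic s).indicator (fun _ => (1 : ℝ)) := by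
    ext t
    simp [truncPow, indicator]
  rw [truncMoment, this, integral_indicator measurableSet_Iic]
  simp

theorem truncMoment_right {ν : Measure ℝ} {a b : ℝ} (hν : ∀ᵐ t ∂ν, t ∈ Ioc a b) (k : ℕ) :
    truncMoment ν k b = (∫ t, (b - t) ^ k ∂ν) / (k.factorial : ℝ) := by
  rw [truncMoment, ← integral_div]
  refine integral_congr_ae ?_
  filter_upwards [hν] with t ht
  exact if_pos ht.2

section truncMoment

variable {ν : Measure ℝ} [IsFiniteMeasure ν] {a b : ℝ}

theorem integrable_uncurry_truncPow (hν : ∀ᵐ t ∂ν, t ∈ Ioc a b) (k : ℕ) {u v : ℝ} :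
    Integrable (Function.uncurry (truncPow k)) ((volume.restrict (uIoc u v)).prod ν) := by
  have : IsFiniteMeasure (volume.restrict (uIoc u v)) :=
    ⟨by rw [Measure.restrict_apply_univ, uIoc]; exact measure_Ioc_lt_top⟩
  refine Integrable.of_bound (measurable_uncurry_truncPow k).aestronglyMeasurable
    (|max u v - a| ^ k) ?_
  have h1 : ∀ᵐ p ∂((volume.restrict (uIoc u v)).prod ν), p.1 ∈ uIoc u v :=
    Measure.quasiMeasurePreserving_fst.ae (ae_restrict_mem measurableSet_uIoc)
  have h2 : ∀ᵐ p ∂((volume.restrict (uIoc u v)).prod ν), p.2 ∈ Ioc a b :=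
    Measure.quasiMeasurePreserving_snd.ae hν
  filter_upwards [h1, h2] with p hp1 hp2
  exact norm_truncPow_le k hp1.2 hp2.1.le

theorem intervalIntegrable_truncMoment (hν : ∀ᵐ t ∂ν, t ∈ Ioc a b) (k : ℕ) (u v : ℝ) :
    IntervalIntegrable (truncMoment ν k) volume u v :=
  intervalIntegrable_iff.2 (integrable_uncurry_truncPow hν k).integral_prod_left

theorem integral_truncMoment (hν : ∀ᵐ t ∂ν, t ∈ Ioc a b) (k : ℕ) {s : ℝ} (hs : a ≤ s) :
    ∫ r in a..s, truncMoment ν k r = truncMoment ν (k + 1) s := by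
  unfold truncMoment
  rw [intervalIntegral_integral_swap (integrable_uncurry_truncPow hν k)]
  refine integral_congr_ae ?_
  filter_upwards [hν] with t ht
  exact integral_truncPow k ht.1.le hs

theorem continuousWithinAt_truncMoment (hν : ∀ᵐ t ∂ν, t ∈ Ioc a b) (k : ℕ) (s : ℝ) :
    ContinuousWithinAt (truncMoment ν k) (Ici s) s := by
  refine continuousWithinAt_of_dominated (bound := fun _ => |s + 1 - a| ^ k)
    (Filter.Eventually.of_forall fun r => (measurable_truncPow k r).aestronglyMeasurable) ?_
    (integrable_const _) (Filter.Eventually.of_forall fun t => ?_)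
  · filter_upwards [mem_nhdsWithin_of_mem_nhds (Iic_mem_nhds (lt_add_one s))] with r hr
    filter_upwards [hν] with t ht
    exact norm_truncPow_le k hr ht.1.le
  · by_cases hts : t ≤ s
    · have hc : ContinuousWithinAt (fun r => (r - t) ^ k / (k.factorial : ℝ)) (Ici s) s := by
        fun_prop
      exact hc.congr (fun r hr => if_pos (hts.trans hr)) (if_pos hts)
    · refine ContinuousAt.continuousWithinAt ?_
      refine (continuousAt_const (y := (0 : ℝ))).congr ?_
      filter_upwards [Iio_mem_nhds (not_le.1 hts)] with r hr
      exact (if_neg (not_le.2 hr)).symm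

theorem Continuous.integrable_of_ae_mem_Ioc {g : ℝ → ℝ} (hg : Continuous g)
    (hν : ∀ᵐ t ∂ν, t ∈ Ioc a b) : Integrable g ν := by
  have h := (hg.continuousOn.integrableOn_compact (μ := ν) (isCompact_Icc (a := a) (b := b)))
  rwa [IntegrableOn,
    Measure.restrict_eq_self_of_ae_mem (hν.mono fun t ht => Ioc_subset_Icc_self ht)] at h

theorem integral_pow_eq_truncMoment (hν : ∀ᵐ t ∂ν, t ∈ Ioc a b) {n : ℕ} (hn : n ≠ 0) (c : ℝ) :
    ∫ t, max (t - c) 0 ^ n ∂ν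
      = (-1) ^ n * ((∫ t, (c - t) ^ n ∂ν) - n.factorial * truncMoment ν n c) := by
  have hpt : ∀ t, max (t - c) 0 ^ n
      = (-1) ^ n * ((c - t) ^ n - n.factorial * truncPow n c t) := by
    intro t
    have hf : (n.factorial : ℝ) ≠ 0 := by exact_mod_cast n.factorial_ne_zero
    by_cases h : t ≤ c
    · rw [truncPow, if_pos h, max_eq_right (by linarith), zero_pow hn]
      field_simp
      simp
    · rw [truncPow, if_neg h, max_eq_left (by linarith), mul_zero, sub_zero, ← mul_pow]
      ring
  have hi : Integrable (truncPow n c) ν := by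
    refine Integrable.of_bound (measurable_truncPow n c).aestronglyMeasurable (|c - a| ^ n) ?_
    filter_upwards [hν] with t ht
    exact norm_truncPow_le n le_rfl ht.1.le
  simp_rw [hpt]
  rw [integral_const_mul, integral_sub
    (Continuous.integrable_of_ae_mem_Ioc (by fun_prop) hν) (hi.const_mul _), integral_const_mul]
  rfl

theorem integral_sub_pow_eq_sum (hν : ∀ᵐ t ∂ν, t ∈ Ioc a b) (n : ℕ) (c : ℝ) :
    ∫ t, (c - t) ^ n ∂ν = ∑ k ∈ Finset.range (n + 1),
      (∫ t, (b - t) ^ k ∂ν) * ((c - b) ^ (n - k) * (n.choose k : ℝ)) := by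
  have hpt : ∀ t, (c - t) ^ n = ∑ k ∈ Finset.range (n + 1),
      (b - t) ^ k * ((c - b) ^ (n - k) * (n.choose k : ℝ)) := by
    intro t
    rw [show c - t = (b - t) + (c - b) by ring, add_pow]
    simp_rw [mul_assoc]
  simp_rw [hpt]
  rw [integral_finsetSum]
  · simp_rw [integral_mul_const]
  · exact fun k _ => Continuous.integrable_of_ae_mem_Ioc (by fun_prop) hν

end truncMoment

theorem iterInt_eq_truncMoment {P N : Measure ℝ} [IsFiniteMeasure P] [IsFiniteMeasure N]
    {a b : ℝ} (hP : ∀ᵐ t ∂P, t ∈ Ioc a b) (hN : ∀ᵐ t ∂N, t ∈ Ioc a b) {F : ℝ → ℝ}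
    (hF : ∀ s, F s = P.real (Iic s) - N.real (Iic s)) (k : ℕ) {s : ℝ} (hs : a ≤ s) :
    iterInt a F k s = truncMoment P k s - truncMoment N k s := by
  induction k generalizing s with
  | zero => rw [iterInt, hF, truncMoment_zero, truncMoment_zero]
  | succ k ih =>
    rw [iterInt, ← integral_truncMoment hP k hs, ← integral_truncMoment hN k hs,
      ← intervalIntegral.integral_sub (intervalIntegrable_truncMoment hP k a s)
        (intervalIntegrable_truncMoment hN k a s)]
    refine intervalIntegral.integral_congr fun r hr => ?_
    rw [uIcc_of_le hs] at hr
    exact ih hr.1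

theorem intervalIntegral_pos_of_continuousWithinAt_Ici {h : ℝ → ℝ} {p q t₀ : ℝ}
    (hint : IntervalIntegrable h volume p q) (hnn : ∀ t ∈ Ioo p q, 0 ≤ h t)
    (ht₀ : t₀ ∈ Ioo p q) (hpos : 0 < h t₀) (hc : ContinuousWithinAt h (Ici t₀) t₀) :
    0 < ∫ t in p..q, h t := by
  have hpq : p < q := ht₀.1.trans ht₀.2
  rw [intervalIntegral.integral_of_le hpq.le, integral_Ioc_eq_integral_Ioo,
    setIntegral_pos_iff_support_of_nonneg_ae
      ((ae_restrict_mem measurableSet_Ioo).mono hnn)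
      ((intervalIntegrable_iff_integrableOn_Ioo_of_le hpq.le).1 hint)]
  obtain ⟨u, hu, hsub⟩ := (mem_nhdsGE_iff_exists_Ico_subset' ht₀.2).1
    (hc.eventually (lt_mem_nhds hpos))
  have hlt : t₀ < min u q := lt_min hu ht₀.2
  refine lt_of_lt_of_le ?_ (measure_mono (s := Ioo t₀ (min u q)) fun t ht => ⟨?_, ?_, ?_⟩)
  · simpa using hlt
  · exact (show 0 < h t from hsub ⟨ht.1.le, ht.2.trans_le (min_le_left _ _)⟩).ne'
  · exact ht₀.1.trans ht.1
  · exact ht.2.trans_le (min_le_right _ _)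

theorem hasDerivAt_max_sub_zero_pow (c : ℝ) (k : ℕ) (t : ℝ) :
    HasDerivAt (fun t => max (t - c) 0 ^ (k + 2)) ((k + 2 : ℝ) * max (t - c) 0 ^ (k + 1)) t := by
  have key : ∀ y, y ≠ c → HasDerivAt (fun t => max (t - c) 0 ^ (k + 2))
      ((k + 2 : ℝ) * max (y - c) 0 ^ (k + 1)) y := by
    intro y hy
    rcases hy.lt_or_gt with hy | hy
    · rw [max_eq_right (by linarith), zero_pow (by omega), mul_zero]
      refine (hasDerivAt_const y (0 : ℝ)).congr_of_eventuallyEq ?_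
      filter_upwards [Iio_mem_nhds hy] with r hr
      rw [max_eq_right (sub_nonpos.2 (mem_Iio.1 hr).le), zero_pow (by omega)]
    · rw [max_eq_left (by linarith)]
      have h1 := ((hasDerivAt_id y).sub_const c).pow (k + 2)
      refine (h1.congr_deriv (by simp)).congr_of_eventuallyEq ?_
      filter_upwards [Ioi_mem_nhds hy] with r hr
      rw [max_eq_left (sub_nonneg.2 (mem_Ioi.1 hr).le)]
      rfl
  by_cases ht : t = c
  · subst ht
    exact hasDerivAt_of_hasDerivAt_of_ne (g := fun y => (k + 2 : ℝ) * max (y - t) 0 ^ (k + 1))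
      key (by fun_prop) (by fun_prop)
  · exact key t ht

theorem deriv_max_sub_zero_pow (c : ℝ) (k : ℕ) :
    deriv (fun t => max (t - c) 0 ^ (k + 2))
      = fun t => (k + 2 : ℝ) * max (t - c) 0 ^ (k + 1) :=
  funext fun t => (hasDerivAt_max_sub_zero_pow c k t).deriv

theorem contDiff_max_sub_zero_pow (c : ℝ) (k : ℕ) :
    ContDiff ℝ k (fun t => max (t - c) 0 ^ (k + 1)) := by
  induction k with
  | zero => exact contDiff_zero.2 (by fun_prop)
  | succ k ih =>
    push_cast
    refine contDiff_succ_iff_deriv.2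
      ⟨fun t => (hasDerivAt_max_sub_zero_pow c k t).differentiableAt, fun h => by simp at h, ?_⟩
    rw [deriv_max_sub_zero_pow]
    exact contDiff_const.mul ih

theorem iteratedDeriv_max_sub_zero_pow (c : ℝ) (k : ℕ) (t : ℝ) :
    iteratedDeriv k (fun t => max (t - c) 0 ^ (k + 1)) t
      = ((k + 1).factorial : ℝ) * max (t - c) 0 := by
  induction k with
  | zero => simp
  | succ k ih =>
    rw [iteratedDeriv_succ', deriv_max_sub_zero_pow, iteratedDeriv_const_mul_field, ih,
      Nat.factorial_succ (k + 1)]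
    push_cast
    ring

theorem nConvexOn_max_sub_zero_pow (a b c : ℝ) {n : ℕ} (hn : 1 ≤ n) :
    NConvexOn n a b (fun t => max (t - c) 0 ^ n) := by
  obtain ⟨k, rfl⟩ := Nat.exists_eq_add_of_le' hn
  refine ⟨(contDiff_max_sub_zero_pow c k).contDiffOn, ?_⟩
  have hconv : ConvexOn ℝ (Ioo a b) fun t => ((k + 1).factorial : ℝ) * max (t - c) 0 := by
    have h := ((convexOn_id (𝕜 := ℝ) (convex_Ioo a b)).sub
      (concaveOn_const c (convex_Ioo a b))).sup (convexOn_const 0 (convex_Ioo a b))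
    exact h.smul (Nat.cast_nonneg _)
  refine hconv.congr fun t ht => ?_
  rw [Nat.add_sub_cancel, iteratedDerivWithin_of_isOpen isOpen_Ioo ht,
    iteratedDeriv_max_sub_zero_pow]

theorem ConcentratedOn.ae_mem {μ : SignedMeasure ℝ} {s : Set ℝ} (h : ConcentratedOn μ s) :
    (∀ᵐ t ∂μ.toJordanDecomposition.posPart, t ∈ s) ∧
      ∀ᵐ t ∂μ.toJordanDecomposition.negPart, t ∈ s := by
  exact ae_add_measure_iff.1 h

theorem ConcentratedOn.apply_Ioc {μ : SignedMeasure ℝ} {a b : ℝ}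
    (h : ConcentratedOn μ (Ioc a b)) (s : ℝ) :
    μ (Ioc a s) = μ.toJordanDecomposition.posPart.real (Iic s)
      - μ.toJordanDecomposition.negPart.real (Iic s) := by
  have key : ∀ ν : Measure ℝ, (∀ᵐ t ∂ν, t ∈ Ioc a b) → ν.real (Ioc a s) = ν.real (Iic s) := by
    intro ν hν
    refine measureReal_congr ?_
    filter_upwards [hν] with t ht
    exact propext ⟨fun h => h.2, fun h => ⟨ht.1, h⟩⟩
  conv_lhs => rw [← SignedMeasure.toSignedMeasure_toJordanDecomposition μ]
  rw [JordanDecomposition.toSignedMeasure, sub_apply,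
    Measure.toSignedMeasure_apply_measurable measurableSet_Ioc,
    Measure.toSignedMeasure_apply_measurable measurableSet_Ioc, key _ h.ae_mem.1,
    key _ h.ae_mem.2]

theorem ConcentratedOn.sintegralOn_Icc {μ : SignedMeasure ℝ} {a b : ℝ}
    (h : ConcentratedOn μ (Ioc a b)) (f : ℝ → ℝ) :
    sintegralOn μ (Icc a b) f = sintegral μ f := by
  unfold sintegralOn sintegral
  rw [Measure.restrict_eq_self_of_ae_mem (h.ae_mem.1.mono fun t ht => Ioc_subset_Icc_self ht),
    Measure.restrict_eq_self_of_ae_mem (h.ae_mem.2.mono fun t ht => Ioc_subset_Icc_self ht)]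

/-- **Corollary 2.7b, even case.** If `H_k(b) = 0` for `k = 0,…,n` and `H_{n−1}` changes
sign exactly at `x₁ < ⋯ < x_m` with `m` even, starting with sign `(−1)^{n+1}` on `(a,x₁)`,
then the inequality `∫ f dμ₁ ≤ ∫ f dμ₂` fails for some continuous `n`-convex `f`. -/
theorem statement10 (a b : ℝ) (hab : a < b) (n : ℕ) (hn : 1 ≤ n)
    (μ₁ μ₂ : SignedMeasure ℝ)
    (hμ₁ : ConcentratedOn μ₁ (Ioc a b)) (hμ₂ : ConcentratedOn μ₂ (Ioc a b))
    (F₁ F₂ : ℝ → ℝ)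
    (hF₁ : ∀ x, F₁ x = μ₁ (Ioc a x)) (hF₂ : ∀ x, F₂ x = μ₂ (Ioc a x))
    (hHb : ∀ k ≤ n, iterInt a (fun t => F₂ t - F₁ t) k b = 0)
    (m : ℕ) (hm : Even m) (x : ℕ → ℝ)
    (hx0 : x 0 = a) (hxlast : x (m + 1) = b)
    (hmono : ∀ i ≤ m, x i < x (i + 1))
    (hsign : ∀ i ≤ m, ∀ t ∈ Ioo (x i) (x (i + 1)),
      0 ≤ (-1 : ℝ) ^ (n + 1 + i) * iterInt a (fun t => F₂ t - F₁ t) (n - 1) t)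
    (hnz : ∀ i ≤ m, ∃ t ∈ Ioo (x i) (x (i + 1)),
      iterInt a (fun t => F₂ t - F₁ t) (n - 1) t ≠ 0) :
    ∃ f : ℝ → ℝ, ContinuousOn f (Icc a b) ∧ NConvexOn n a b f ∧
      sintegralOn μ₂ (Icc a b) f < sintegralOn μ₁ (Icc a b) f := by
  set P := μ₂.toJordanDecomposition.posPart + μ₁.toJordanDecomposition.negPart with hPdef
  set N := μ₂.toJordanDecomposition.negPart + μ₁.toJordanDecomposition.posPart with hNdef
  have hP : ∀ᵐ t ∂P, t ∈ Ioc a b := ae_add_measure_iff.2 ⟨hμ₂.ae_mem.1, hμ₁.ae_mem.2⟩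
  have hN : ∀ᵐ t ∂N, t ∈ Ioc a b := ae_add_measure_iff.2 ⟨hμ₂.ae_mem.2, hμ₁.ae_mem.1⟩
  have hF : ∀ s, F₂ s - F₁ s = P.real (Iic s) - N.real (Iic s) := by
    intro s
    rw [hF₁, hF₂, hμ₁.apply_Ioc, hμ₂.apply_Ioc, hPdef, hNdef, measureReal_add_apply,
      measureReal_add_apply]
    ring
  have hH : ∀ k s, a ≤ s → iterInt a (fun t => F₂ t - F₁ t) k s
      = truncMoment P k s - truncMoment N k s :=
    fun k s hs => iterInt_eq_truncMoment hP hN hF k hs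
  have hac : a ≤ x m := by
    have : ∀ i ≤ m, a ≤ x i := by
      intro i
      induction i with
      | zero => exact fun _ => hx0.ge
      | succ i ih => exact fun hi => (ih (by omega)).trans (hmono i (by omega)).le
    exact this m le_rfl
  set c := x m with hc
  have hcb : c < b := hxlast ▸ hmono m le_rfl
  have hmom : ∀ k ≤ n, truncMoment P k b = truncMoment N k b := fun k hk =>
    sub_eq_zero.1 ((hH k b hab.le).symm.trans (hHb k hk))
  have hpow : ∀ k ≤ n, ∫ t, (b - t) ^ k ∂P = ∫ t, (b - t) ^ k ∂N := by
    intro k hk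
    have h := hmom k hk
    rw [truncMoment_right hP, truncMoment_right hN] at h
    exact (div_left_inj' (by exact_mod_cast k.factorial_ne_zero)).1 h
  have hpowc : ∫ t, (c - t) ^ n ∂P = ∫ t, (c - t) ^ n ∂N := by
    rw [integral_sub_pow_eq_sum hP, integral_sub_pow_eq_sum hN]
    refine Finset.sum_congr rfl fun k hk => ?_
    rw [hpow k (by simpa [Nat.lt_succ_iff] using hk)]
  have hneg : (-1 : ℝ) ^ (n + 1) * (truncMoment P n c - truncMoment N n c) < 0 := by
    set h : ℝ → ℝ := fun t => (-1 : ℝ) ^ (n + 1) *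
      (truncMoment P (n - 1) t - truncMoment N (n - 1) t) with hdef
    have hint : ∀ u v, IntervalIntegrable
        (fun t => truncMoment P (n - 1) t - truncMoment N (n - 1) t) volume u v := fun u v =>
      (intervalIntegrable_truncMoment hP _ u v).sub (intervalIntegrable_truncMoment hN _ u v)
    have hnn : ∀ t ∈ Ioo c b, 0 ≤ h t := by
      intro t ht
      have h1 := hsign m le_rfl t (by rwa [hxlast])
      rwa [pow_add, hm.neg_one_pow, mul_one, hH _ _ (hac.trans ht.1.le)] at h1
    obtain ⟨t₀, ht₀, hne⟩ := hnz m le_rfl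
    rw [hxlast] at ht₀
    rw [hH _ _ (hac.trans ht₀.1.le)] at hne
    have hpos : 0 < h t₀ := lt_of_le_of_ne (hnn t₀ ht₀)
      (mul_ne_zero (pow_ne_zero _ (by norm_num)) hne).symm
    have hint_pos := intervalIntegral_pos_of_continuousWithinAt_Ici
      ((hint c b).const_mul _) hnn ht₀ hpos
      (continuousWithinAt_const.mul ((continuousWithinAt_truncMoment hP _ _).sub
        (continuousWithinAt_truncMoment hN _ _)))
    have hprim : ∀ s, a ≤ s → ∫ t in a..s, (truncMoment P (n - 1) t - truncMoment N (n - 1) t)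
        = truncMoment P n s - truncMoment N n s := by
      intro s hs
      rw [intervalIntegral.integral_sub (intervalIntegrable_truncMoment hP _ _ _)
        (intervalIntegrable_truncMoment hN _ _ _), integral_truncMoment hP _ hs,
        integral_truncMoment hN _ hs, Nat.sub_add_cancel hn]
    have hadj := intervalIntegral.integral_add_adjacent_intervals (hint a c) (hint c b)
    rw [hprim c hac, hprim b hab.le, hmom n le_rfl, sub_self] at hadj
    rw [intervalIntegral.integral_const_mul] at hint_pos
    rw [eq_neg_of_add_eq_zero_left hadj]
    linarith
  set f : ℝ → ℝ := fun t => max (t - c) 0 ^ n with hfdef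
  have hfc : Continuous f := by fun_prop
  refine ⟨f, hfc.continuousOn, nConvexOn_max_sub_zero_pow a b c hn, ?_⟩
  have hdiff : ∫ t, f t ∂P - ∫ t, f t ∂N < 0 := by
    rw [integral_pow_eq_truncMoment hP (by omega), integral_pow_eq_truncMoment hN (by omega),
      hpowc]
    have hfac : (0 : ℝ) < n.factorial := by exact_mod_cast n.factorial_pos
    have := mul_neg_of_pos_of_neg hfac hneg
    rw [pow_succ] at this
    linarith
  have hPi : ∫ t, f t ∂P = _ := integral_add_measure
    (hfc.integrable_of_ae_mem_Ioc hμ₂.ae_mem.1) (hfc.integrable_of_ae_mem_Ioc hμ₁.ae_mem.2)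
  have hNi : ∫ t, f t ∂N = _ := integral_add_measure
    (hfc.integrable_of_ae_mem_Ioc hμ₂.ae_mem.2) (hfc.integrable_of_ae_mem_Ioc hμ₁.ae_mem.1)
  rw [hPi, hNi] at hdiff
  rw [hμ₁.sintegralOn_Icc, hμ₂.sintegralOn_Icc, sintegral, sintegral]
  linarith
end

section
/- Let f : [−1,1] → ℝ be a continuous 3-convex function, i.e., f is twice differentiable on (−1,1) and f″ is convex on (−1,1). Then (1/3)·(f(−√2/2) + f(0) + f(√2/2)) ≤ (1/12)·(f(−1) + f(1)) + (5/12)·(f(−√5/5) + f(√5/5)). In other words, the Chebyshev quadrature operator C(f) = (1/3)(f(−√2/2) + f(0) + f(√2/2)) is dominated by the Lobatto quadrature operator L₄(f) = (1/12)(f(−1) + f(1)) + (5/12)(f(−√5/5) + f(√5/5)) on 3-convex functions. -/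
open MeasureTheory Set

/-- The derivatives within `(a,b)` of a `C^n` function on `(a,b)` are honest derivatives. -/
lemma hasDerivAt_iteratedDerivWithin_Ioo {f : ℝ → ℝ} {a b : ℝ} {n : ℕ∞} {k : ℕ}
    (hf : ContDiffOn ℝ n f (Ioo a b)) (hk : (k : ℕ∞) < n) {x : ℝ} (hx : x ∈ Ioo a b) :
    HasDerivAt (iteratedDerivWithin k f (Ioo a b))
      (iteratedDerivWithin (k + 1) f (Ioo a b) x) x := by
  have hd := (hf.differentiableOn_iteratedDerivWithin (m := k) (by exact_mod_cast hk)
    isOpen_Ioo.uniqueDiffOn) x hx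
  rw [iteratedDerivWithin_succ]
  exact hd.hasDerivWithinAt.hasDerivAt (isOpen_Ioo.mem_nhds hx)

/-- An even convex function on `(-1,1)` is nondecreasing on `[0,1)`. -/
lemma ConvexOn.le_of_even {g : ℝ → ℝ} (hg : ConvexOn ℝ (Ioo (-1) 1) g)
    (heven : ∀ x, g (-x) = g x) {a b : ℝ} (ha : 0 ≤ a) (hab : a ≤ b) (hb : b < 1) :
    g a ≤ g b := by
  have h := hg.le_max_of_mem_Icc (x := -b) (y := b) (z := a)
    ⟨by linarith, by linarith⟩ ⟨by linarith, by linarith⟩ ⟨by linarith, hab⟩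
  simpa [heven] using h

/-- If `r` has a double zero at `0` and zeros at `s` and `1`, then `r''` vanishes at two points. -/
lemma exists_two_zeros_snd_deriv {r r₁ r₂ : ℝ → ℝ} {s : ℝ} (hs₀ : 0 < s) (hs₁ : s < 1)
    (hc : ContinuousOn r (Icc 0 1))
    (h₁ : ∀ x ∈ Ico (0 : ℝ) 1, HasDerivAt r (r₁ x) x)
    (h₂ : ∀ x ∈ Ico (0 : ℝ) 1, HasDerivAt r₁ (r₂ x) x)
    (hr₀ : r 0 = 0) (hr₁ : r₁ 0 = 0) (hrs : r s = 0) (hr : r 1 = 0) :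
    ∃ a b, 0 < a ∧ a < b ∧ b < 1 ∧ r₂ a = 0 ∧ r₂ b = 0 := by
  have hc₁ : ∀ x y, 0 ≤ x → y < 1 → ContinuousOn r₁ (Icc x y) := fun x y hx hy z hz =>
    (h₂ z ⟨hx.trans hz.1, hz.2.trans_lt hy⟩).continuousAt.continuousWithinAt
  obtain ⟨m, hm, hm'⟩ := exists_hasDerivAt_eq_zero hs₀ (hc.mono (Icc_subset_Icc_right hs₁.le))
    (hr₀.trans hrs.symm) (fun x hx => h₁ x ⟨hx.1.le, hx.2.trans hs₁⟩)
  obtain ⟨p, hp, hp'⟩ := exists_hasDerivAt_eq_zero hs₁ (hc.mono (Icc_subset_Icc_left hs₀.le))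
    (hrs.trans hr.symm) (fun x hx => h₁ x ⟨(hs₀.trans hx.1).le, hx.2⟩)
  obtain ⟨a, ha, ha'⟩ := exists_hasDerivAt_eq_zero hm.1 (hc₁ 0 m le_rfl (hm.2.trans hs₁))
    (hr₁.trans hm'.symm) (fun x hx => h₂ x ⟨hx.1.le, hx.2.trans (hm.2.trans hs₁)⟩)
  obtain ⟨b, hb, hb'⟩ := exists_hasDerivAt_eq_zero (hm.2.trans hp.1) (hc₁ m p hm.1.le hp.2)
    (hm'.trans hp'.symm) (fun x hx => h₂ x ⟨(hm.1.trans hx.1).le, hx.2.trans hp.2⟩)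
  exact ⟨a, b, ha.1, ha.2.trans hb.1, hb.2.trans hp.2, ha', hb'⟩

/-- If `r` has a double zero at `0` and zeros at `s` and `1`, and `r''` is convex, then
`r ≤ 0` between `s` and `1`. -/
lemma nonpos_of_convexOn_snd_deriv {r r₁ r₂ : ℝ → ℝ} {s t : ℝ} (hs₀ : 0 < s) (hst : s < t)
    (ht : t < 1) (hc : ContinuousOn r (Icc 0 1))
    (h₁ : ∀ x ∈ Ico (0 : ℝ) 1, HasDerivAt r (r₁ x) x)
    (h₂ : ∀ x ∈ Ico (0 : ℝ) 1, HasDerivAt r₁ (r₂ x) x)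
    (hconv : ConvexOn ℝ (Ico 0 1) r₂)
    (hr₀ : r 0 = 0) (hr₁ : r₁ 0 = 0) (hrs : r s = 0) (hr : r 1 = 0) : r t ≤ 0 := by
  by_contra! hpos
  have hs₁ := hst.trans ht
  have hc₁ : ∀ x y, 0 ≤ x → y < 1 → ContinuousOn r₁ (Icc x y) := fun x y hx hy z hz =>
    (h₂ z ⟨hx.trans hz.1, hz.2.trans_lt hy⟩).continuousAt.continuousWithinAt
  obtain ⟨m, hm, hm'⟩ := exists_hasDerivAt_eq_zero hs₀ (hc.mono (Icc_subset_Icc_right hs₁.le))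
    (hr₀.trans hrs.symm) (fun x hx => h₁ x ⟨hx.1.le, hx.2.trans hs₁⟩)
  obtain ⟨p, hp, hp'⟩ := exists_hasDerivAt_eq_slope r r₁ hst
    (hc.mono (Icc_subset_Icc hs₀.le ht.le)) (fun x hx => h₁ x ⟨(hs₀.trans hx.1).le, hx.2.trans ht⟩)
  obtain ⟨q, hq, hq'⟩ := exists_hasDerivAt_eq_slope r r₁ ht
    (hc.mono (Icc_subset_Icc_left (hs₀.trans hst).le))
    (fun x hx => h₁ x ⟨((hs₀.trans hst).trans hx.1).le, hx.2⟩)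
  have hp_pos : 0 < r₁ p := by
    rw [hp', hrs, sub_zero]; exact div_pos hpos (sub_pos.2 hst)
  have hq_neg : r₁ q < 0 := by
    rw [hq', hr, zero_sub]; exact div_neg_of_neg_of_pos (neg_lt_zero.2 hpos) (sub_pos.2 ht)
  have hmp := hm.2.trans hp.1
  have hpq := hp.2.trans hq.1
  obtain ⟨a, ha, ha'⟩ := exists_hasDerivAt_eq_zero hm.1 (hc₁ 0 m le_rfl (hm.2.trans hs₁))
    (hr₁.trans hm'.symm) (fun x hx => h₂ x ⟨hx.1.le, hx.2.trans (hm.2.trans hs₁)⟩)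
  obtain ⟨b, hb, hb'⟩ := exists_hasDerivAt_eq_slope r₁ r₂ hmp (hc₁ m p hm.1.le (hpq.trans hq.2))
    (fun x hx => h₂ x ⟨(hm.1.trans hx.1).le, hx.2.trans (hpq.trans hq.2)⟩)
  obtain ⟨e, he, he'⟩ := exists_hasDerivAt_eq_slope r₁ r₂ hpq
    (hc₁ p q (hm.1.trans hmp).le hq.2)
    (fun x hx => h₂ x ⟨((hm.1.trans hmp).trans hx.1).le, hx.2.trans hq.2⟩)
  have hb_pos : 0 < r₂ b := by
    rw [hb', hm', sub_zero]; exact div_pos hp_pos (sub_pos.2 hmp)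
  have he_neg : r₂ e < 0 := by
    rw [he']; exact div_neg_of_neg_of_pos (by linarith) (sub_pos.2 hpq)
  have hmax := hconv.le_max_of_mem_Icc (x := a) (y := e) (z := b)
    ⟨ha.1.le, (ha.2.trans hmp).trans (hpq.trans hq.2)⟩
    ⟨((hm.1.trans hmp).trans he.1).le, he.2.trans hq.2⟩
    ⟨(ha.2.trans hb.1).le, (hb.2.trans he.1).le⟩
  rw [ha', max_eq_left he_neg.le] at hmax
  exact hmax.not_gt hb_pos

/-- Upper bound by the interpolating polynomial `g 0 + β x² + γ x³`, for `g` even with `g''`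
convex, together with the sign of its leading coefficient. -/
lemma exists_cubic_interpolation {g g₁ g₂ : ℝ → ℝ} {s t : ℝ} (hs₀ : 0 < s) (hst : s < t)
    (ht : t < 1) (hc : ContinuousOn g (Icc (-1) 1))
    (h₁ : ∀ x ∈ Ioo (-1 : ℝ) 1, HasDerivAt g (g₁ x) x)
    (h₂ : ∀ x ∈ Ioo (-1 : ℝ) 1, HasDerivAt g₁ (g₂ x) x)
    (hconv : ConvexOn ℝ (Ioo (-1) 1) g₂) (heven : ∀ x, g₂ (-x) = g₂ x) (hg₁ : g₁ 0 = 0) :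
    ∃ β γ : ℝ, 0 ≤ γ ∧ g s = g 0 + β * s ^ 2 + γ * s ^ 3 ∧ g 1 = g 0 + β + γ ∧
      g t ≤ g 0 + β * t ^ 2 + γ * t ^ 3 := by
  have hs₁ : s < 1 := hst.trans ht
  obtain ⟨β, γ, hgs, hg⟩ : ∃ β γ : ℝ, g s = g 0 + β * s ^ 2 + γ * s ^ 3 ∧ g 1 = g 0 + β + γ := by
    have h1s : 1 - s ≠ 0 := (sub_pos.2 hs₁).ne'
    refine ⟨(g 1 - g 0) - ((g 1 - g 0) - (g s - g 0) / s ^ 2) / (1 - s),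
      ((g 1 - g 0) - (g s - g 0) / s ^ 2) / (1 - s), ?_, by ring⟩
    field_simp
    ring
  let r : ℝ → ℝ := fun x => g x - (g 0 + β * x ^ 2 + γ * x ^ 3)
  let r₁ : ℝ → ℝ := fun x => g₁ x - (2 * β * x + 3 * γ * x ^ 2)
  let r₂ : ℝ → ℝ := fun x => g₂ x - (2 * β + 6 * γ * x)
  have hsub : ∀ x ∈ Ico (0 : ℝ) 1, x ∈ Ioo (-1 : ℝ) 1 := fun x hx => ⟨by linarith [hx.1], hx.2⟩
  have hrc : ContinuousOn r (Icc 0 1) :=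
    (hc.mono (Icc_subset_Icc_left (by norm_num))).sub (by fun_prop)
  have hr₁ : ∀ x ∈ Ico (0 : ℝ) 1, HasDerivAt r (r₁ x) x := fun x hx => by
    have hp : HasDerivAt (fun x : ℝ => g 0 + β * x ^ 2 + γ * x ^ 3)
        (2 * β * x + 3 * γ * x ^ 2) x := by
      refine HasDerivAt.congr_deriv ((((hasDerivAt_pow 2 x).const_mul β).const_add (g 0)).add
        ((hasDerivAt_pow 3 x).const_mul γ)) ?_
      push_cast
      ring
    exact (h₁ x (hsub x hx)).sub hp
  have hr₂ : ∀ x ∈ Ico (0 : ℝ) 1, HasDerivAt r₁ (r₂ x) x := fun x hx => by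
    have hp : HasDerivAt (fun x : ℝ => 2 * β * x + 3 * γ * x ^ 2) (2 * β + 6 * γ * x) x := by
      refine HasDerivAt.congr_deriv (((hasDerivAt_id x).const_mul (2 * β)).add
        ((hasDerivAt_pow 2 x).const_mul (3 * γ))) ?_
      push_cast
      ring
    exact (h₂ x (hsub x hx)).sub hp
  have hr_zero : r 0 = 0 := by simp [r]
  have hr₁_zero : r₁ 0 = 0 := by simp [r₁, hg₁]
  have hr_s : r s = 0 := by simp only [r]; linarith
  have hr_one : r 1 = 0 := by simp only [r]; linarith
  have hr₂_conv : ConvexOn ℝ (Ico 0 1) r₂ := by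
    refine ⟨convex_Ico 0 1, fun x hx y hy a b ha hb hab => ?_⟩
    have h := hconv.2 (hsub x hx) (hsub y hy) ha hb hab
    simp only [r₂, smul_eq_mul] at h ⊢
    linear_combination h + 2 * β * hab
  refine ⟨β, γ, ?_, hgs, hg, ?_⟩
  · obtain ⟨a, b, ha, hab, hb, ha', hb'⟩ := exists_two_zeros_snd_deriv hs₀ hs₁ hrc hr₁ hr₂
      hr_zero hr₁_zero hr_s hr_one
    have hle := hconv.le_of_even heven ha.le hab.le hb
    simp only [r₂] at ha' hb'
    by_contra! hneg
    nlinarith [mul_pos_of_neg_of_neg hneg (sub_neg.2 hab)]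
  · have := nonpos_of_convexOn_snd_deriv hs₀ hst ht hrc hr₁ hr₂ hr₂_conv
      hr_zero hr₁_zero hr_s hr_one
    simp only [r] at this
    linarith

/-- **Inequality (w3): Chebyshev vs. Lobatto quadrature.** For every continuous 3-convex
function `f : [−1,1] → ℝ` (i.e. `f″` exists and is convex on `(−1,1)`),
`C(f) ≤ L₄(f)`. -/
theorem statement12 (f : ℝ → ℝ)
    (hf : ContinuousOn f (Icc (-1 : ℝ) 1))
    (hconv : NConvexOn 3 (-1 : ℝ) 1 f) :
    (1 / 3 : ℝ) * (f (-(Real.sqrt 2 / 2)) + f 0 + f (Real.sqrt 2 / 2)) ≤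
      (1 / 12 : ℝ) * (f (-1) + f 1) +
        (5 / 12 : ℝ) * (f (-(Real.sqrt 5 / 5)) + f (Real.sqrt 5 / 5)) := by
  obtain ⟨hd, hcv⟩ := hconv
  norm_num only at hd hcv
  let D : ℕ → ℝ → ℝ := fun k => iteratedDerivWithin k f (Ioo (-1) 1)
  have hneg : ∀ x ∈ Ioo (-1 : ℝ) 1, -x ∈ Ioo (-1 : ℝ) 1 := fun x hx =>
    ⟨by linarith [hx.2], by linarith [hx.1]⟩
  have hD₁ : ∀ x ∈ Ioo (-1 : ℝ) 1, HasDerivAt f (D 1 x) x := fun x hx => by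
    simpa [D] using hasDerivAt_iteratedDerivWithin_Ioo (k := 0) hd (by norm_num) hx
  have hD₂ : ∀ x ∈ Ioo (-1 : ℝ) 1, HasDerivAt (D 1) (D 2 x) x := fun x hx =>
    hasDerivAt_iteratedDerivWithin_Ioo hd (by norm_num) hx
  have hcomp : ∀ (u : ℝ → ℝ) (v x : ℝ), HasDerivAt u v (-x) →
      HasDerivAt (fun y => u (-y)) (-v) x := fun u v x h => by
    simpa [Function.comp_def] using h.comp x (hasDerivAt_neg x)
  have hc : ContinuousOn (fun x => f x + f (-x)) (Icc (-1) 1) :=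
    hf.add (hf.comp continuousOn_neg fun x hx => ⟨by linarith [hx.2], by linarith [hx.1]⟩)
  have hconv₂ : ConvexOn ℝ (Ioo (-1) 1) (fun x => D 2 x + D 2 (-x)) := by
    refine ⟨convex_Ioo _ _, fun x hx y hy a b ha hb hab => ?_⟩
    have h := hcv.2 hx hy ha hb hab
    have h' := hcv.2 (hneg x hx) (hneg y hy) ha hb hab
    have he : -(a • x + b • y) = a • -x + b • -y := by simp only [smul_eq_mul]; ring
    simp only [D]
    rw [he]
    simp only [smul_eq_mul] at h h' ⊢
    linarith
  have h5 : Real.sqrt 5 ^ 2 = 5 := Real.sq_sqrt (by norm_num)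
  have h2 : Real.sqrt 2 ^ 2 = 2 := Real.sq_sqrt (by norm_num)
  have h5lo : (2.236 : ℝ) < Real.sqrt 5 := Real.lt_sqrt_of_sq_lt (by norm_num)
  have h5hi : Real.sqrt 5 < 2.237 := (Real.sqrt_lt' (by norm_num)).2 (by norm_num)
  have h2lo : (1.414 : ℝ) < Real.sqrt 2 := Real.lt_sqrt_of_sq_lt (by norm_num)
  have h2hi : Real.sqrt 2 < 1.415 := (Real.sqrt_lt' (by norm_num)).2 (by norm_num)
  obtain ⟨β, γ, hγ, hs, h1, ht⟩ := exists_cubic_interpolation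
    (g := fun x => f x + f (-x)) (g₁ := fun x => D 1 x - D 1 (-x))
    (g₂ := fun x => D 2 x + D 2 (-x)) (s := Real.sqrt 5 / 5) (t := Real.sqrt 2 / 2)
    (by linarith) (by linarith) (by linarith) hc
    (fun x hx => ((hD₁ x hx).add (hcomp f _ x (hD₁ _ (hneg x hx)))).congr_deriv
      (sub_eq_add_neg _ _).symm)
    (fun x hx => ((hD₂ x hx).sub (hcomp (D 1) _ x (hD₂ _ (hneg x hx)))).congr_deriv
      (sub_neg_eq_add _ _))
    hconv₂ (fun x => by simp [add_comm]) (by simp)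
  simp only [neg_zero] at hs h1 ht
  have e5 : (Real.sqrt 5 / 5) ^ 2 = 1 / 5 := by rw [div_pow, h5]; norm_num
  have e5' : (Real.sqrt 5 / 5) ^ 3 = Real.sqrt 5 / 25 := by rw [pow_succ, e5]; ring
  have e2 : (Real.sqrt 2 / 2) ^ 2 = 1 / 2 := by rw [div_pow, h2]; norm_num
  have e2' : (Real.sqrt 2 / 2) ^ 3 = Real.sqrt 2 / 4 := by rw [pow_succ, e2]; ring
  rw [e5, e5'] at hs
  rw [e2, e2'] at ht
  have hkey : 0 ≤ γ * (5 + Real.sqrt 5 - 5 * Real.sqrt 2) := mul_nonneg hγ (by linarith)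
  linarith
end

section
/- Let X and Y be the random variables on [−1,1] with distributions μ_X = (1/3)(δ_{−√2/2} + δ₀ + δ_{√2/2}) and μ_Y = (1/12)(δ_{−1} + δ₁) + (5/12)(δ_{−√5/5} + δ_{√5/5}). Set F = F_Y − F_X (difference of distribution functions) and H₃(x) = ∫_{[−1,1]} (t − x)₊³ / 3! d(μ_Y − μ_X)(t). Then H₃(0) = 1/72 + √5/360 − √2/72, and this value is strictly positive. -/
open MeasureTheory Set

/-- The distribution `μ_X = (1/3)(δ_{−√2/2} + δ₀ + δ_{√2/2})` of the Chebyshev quadrature. -/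
noncomputable def muX : Measure ℝ :=
  (3 : ENNReal)⁻¹ •
    (Measure.dirac (-(Real.sqrt 2 / 2)) + Measure.dirac 0 + Measure.dirac (Real.sqrt 2 / 2))

/-- The distribution `μ_Y = (1/12)(δ_{−1} + δ₁) + (5/12)(δ_{−√5/5} + δ_{√5/5})`
of the Lobatto quadrature. -/
noncomputable def muY : Measure ℝ :=
  (12 : ENNReal)⁻¹ • (Measure.dirac (-1 : ℝ) + Measure.dirac (1 : ℝ)) +
    (5 / 12 : ENNReal) •
      (Measure.dirac (-(Real.sqrt 5 / 5)) + Measure.dirac (Real.sqrt 5 / 5))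

theorem integrable_restrict_dirac (f : ℝ → ℝ) (s : Set ℝ) (a : ℝ) :
    Integrable f ((Measure.dirac a).restrict s) :=
  (integrable_dirac (by simp)).integrableOn

theorem setIntegral_dirac_of_mem (f : ℝ → ℝ) {s : Set ℝ} {a : ℝ} (ha : a ∈ s) :
    ∫ t in s, f t ∂Measure.dirac a = f a := by
  classical
  rw [setIntegral_dirac, if_pos ha]

theorem setIntegral_muX (f : ℝ → ℝ) :
    ∫ t in Icc (-1 : ℝ) 1, f t ∂muX =
      (f (-(Real.sqrt 2 / 2)) + f 0 + f (Real.sqrt 2 / 2)) / 3 := by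
  have h2 : Real.sqrt 2 ≤ 2 := Real.sqrt_le_iff.2 (by norm_num)
  have h0 := Real.sqrt_nonneg 2
  have hint := integrable_restrict_dirac f (Icc (-1) 1)
  rw [muX, Measure.restrict_smul, integral_smul_measure, Measure.restrict_add,
    Measure.restrict_add, integral_add_measure ((hint _).add_measure (hint _)) (hint _),
    integral_add_measure (hint _) (hint _),
    setIntegral_dirac_of_mem f (by constructor <;> linarith),
    setIntegral_dirac_of_mem f (by norm_num),
    setIntegral_dirac_of_mem f (by constructor <;> linarith)]
  simp only [ENNReal.toReal_inv, ENNReal.toReal_ofNat, smul_eq_mul]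
  ring

theorem setIntegral_muY (f : ℝ → ℝ) :
    ∫ t in Icc (-1 : ℝ) 1, f t ∂muY =
      (f (-1) + f 1) / 12 + 5 / 12 * (f (-(Real.sqrt 5 / 5)) + f (Real.sqrt 5 / 5)) := by
  have h5 : Real.sqrt 5 ≤ 5 := Real.sqrt_le_iff.2 (by norm_num)
  have h0 := Real.sqrt_nonneg 5
  have hint := integrable_restrict_dirac f (Icc (-1) 1)
  rw [muY, Measure.restrict_add, Measure.restrict_smul, Measure.restrict_smul,
    Measure.restrict_add, Measure.restrict_add,
    integral_add_measure
      (((hint _).add_measure (hint _)).smul_measure (by simp))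
      (((hint _).add_measure (hint _)).smul_measure (by finiteness)),
    integral_smul_measure, integral_smul_measure,
    integral_add_measure (hint _) (hint _), integral_add_measure (hint _) (hint _),
    setIntegral_dirac_of_mem f (by norm_num),
    setIntegral_dirac_of_mem f (by norm_num),
    setIntegral_dirac_of_mem f (by constructor <;> linarith),
    setIntegral_dirac_of_mem f (by constructor <;> linarith)]
  simp only [ENNReal.toReal_inv, ENNReal.toReal_div, ENNReal.toReal_ofNat, smul_eq_mul]
  ring

/-- **Value of `H₃(0)`:** `H₃(0) = ∫_{[−1,1]} (t − 0)₊³/3! d(μ_Y − μ_X)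
= 1/72 + √5/360 − √2/72 > 0`. -/
theorem statement13 :
    (∫ t in Icc (-1 : ℝ) 1, (max (t - 0) 0) ^ 3 / (Nat.factorial 3 : ℝ) ∂muY) -
        (∫ t in Icc (-1 : ℝ) 1, (max (t - 0) 0) ^ 3 / (Nat.factorial 3 : ℝ) ∂muX) =
      1 / 72 + Real.sqrt 5 / 360 - Real.sqrt 2 / 72 ∧
    0 < 1 / 72 + Real.sqrt 5 / 360 - Real.sqrt 2 / 72 := by
  have h2 := Real.sq_sqrt (show (0 : ℝ) ≤ 2 by norm_num)
  have h5 := Real.sq_sqrt (show (0 : ℝ) ≤ 5 by norm_num)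
  have n2 := Real.sqrt_nonneg 2
  have n5 := Real.sqrt_nonneg 5
  constructor
  · rw [setIntegral_muX, setIntegral_muY]
    simp only [sub_zero]
    rw [max_eq_right (show -(Real.sqrt 2 / 2) ≤ 0 by linarith),
      max_eq_left (show 0 ≤ Real.sqrt 2 / 2 by linarith),
      max_eq_right (show -(Real.sqrt 5 / 5) ≤ 0 by linarith),
      max_eq_left (show 0 ≤ Real.sqrt 5 / 5 by linarith), max_self,
      max_eq_right (show (-1 : ℝ) ≤ 0 by norm_num), max_eq_left (zero_le_one' ℝ),
      show (Nat.factorial 3 : ℝ) = 6 by norm_num [Nat.factorial]]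
    linear_combination Real.sqrt 5 / 1800 * h5 - Real.sqrt 2 / 144 * h2
  · have u2 : Real.sqrt 2 < 1.42 := (Real.sqrt_lt' (by norm_num)).2 (by norm_num)
    have l5 : 2.2 < Real.sqrt 5 := Real.lt_sqrt_of_sq_lt (by norm_num)
    linarith
end

section
/- Let X and Y be random variables with distributions μ_X = (1/3)(δ_{−√2/2} + δ₀ + δ_{√2/2}) and μ_Y = (1/12)(δ_{−1} + δ₁) + (5/12)(δ_{−√5/5} + δ_{√5/5}), both concentrated on [−1,1]. Then X is dominated by Y in the 4-convex ordering sense: E[f(X)] ≤ E[f(Y)], i.e., ∫ f dμ_X ≤ ∫ f dμ_Y, for every continuous 3-convex function f : [−1,1] → ℝ. -/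
open MeasureTheory Set

/-- The symmetrization of a convex function is dominated at inner points by outer points. -/
lemma ConvexOn.add_neg_le_add_neg {s : Set ℝ} {φ : ℝ → ℝ} (hφ : ConvexOn ℝ s φ) {k y : ℝ}
    (hk : |k| ≤ 1) (hy : y ∈ s) (hy' : -y ∈ s) :
    φ (k * y) + φ (-(k * y)) ≤ φ y + φ (-y) := by
  obtain ⟨hk₁, hk₂⟩ := abs_le.mp hk
  have h₁ := hφ.2 hy hy' (by linarith : 0 ≤ (1 + k) / 2)
    (by linarith : 0 ≤ (1 - k) / 2) (by ring)
  have h₂ := hφ.2 hy hy' (by linarith : 0 ≤ (1 - k) / 2)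
    (by linarith : 0 ≤ (1 + k) / 2) (by ring)
  simp only [smul_eq_mul] at h₁ h₂
  rw [show (1 + k) / 2 * y + (1 - k) / 2 * -y = k * y by ring] at h₁
  rw [show (1 - k) / 2 * y + (1 + k) / 2 * -y = -(k * y) by ring] at h₂
  linarith

/-- A convex function `φ` satisfies `2 (φ(at) + φ(-at)) ≤ φ(t) + φ(-t) + φ(bt) + φ(-bt)`
whenever `a` is at most the midpoint of `b` and `1`. -/
lemma ConvexOn.two_mul_add_neg_le {φ : ℝ → ℝ} (hφ : ConvexOn ℝ (Ioo (-1 : ℝ) 1) φ)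
    {a b t : ℝ} (ha : 0 ≤ a) (hb : 0 ≤ b) (hb' : b ≤ 1) (hab : a ≤ (1 + b) / 2)
    (ht : t ∈ Ioo (-1 : ℝ) 1) :
    2 * (φ (a * t) + φ (-(a * t))) ≤ φ t + φ (-t) + (φ (b * t) + φ (-(b * t))) := by
  have mem : ∀ c : ℝ, 0 ≤ c → c ≤ 1 → c * t ∈ Ioo (-1 : ℝ) 1 ∧ -(c * t) ∈ Ioo (-1 : ℝ) 1 := by
    intro c hc hc'
    have : |c * t| < 1 := by
      rw [abs_mul, abs_of_nonneg hc]
      exact (mul_le_of_le_one_left (abs_nonneg t) hc').trans_lt (abs_lt.mpr ht)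
    obtain ⟨h₁, h₂⟩ := abs_lt.mp this
    exact ⟨⟨h₁, h₂⟩, ⟨by linarith, by linarith⟩⟩
  have hm : 0 < (1 + b) / 2 := by linarith
  obtain ⟨hmt, hmt'⟩ := mem ((1 + b) / 2) hm.le (by linarith)
  obtain ⟨hbt, hbt'⟩ := mem b hb hb'
  have ht' : -t ∈ Ioo (-1 : ℝ) 1 := ⟨by linarith [ht.2], by linarith [ht.1]⟩
  have h := hφ.add_neg_le_add_neg (k := a / ((1 + b) / 2))
    (by rw [abs_of_nonneg (by positivity)]; exact (div_le_one hm).mpr hab) hmt hmt'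
  rw [show a / ((1 + b) / 2) * ((1 + b) / 2 * t) = a * t by field_simp] at h
  have h₁ := hφ.2 ht hbt (half_pos one_pos).le (half_pos one_pos).le (add_halves 1)
  have h₂ := hφ.2 ht' hbt' (half_pos one_pos).le (half_pos one_pos).le (add_halves 1)
  simp only [smul_eq_mul] at h₁ h₂
  rw [show 1 / 2 * t + 1 / 2 * (b * t) = (1 + b) / 2 * t by ring] at h₁
  rw [show 1 / 2 * -t + 1 / 2 * -(b * t) = -((1 + b) / 2 * t) by ring] at h₂
  linarith

/-- A `3`-convex function has first and second derivatives, the second one being convex. -/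
lemma NConvexOn.exists_hasDerivAt {a b : ℝ} {f : ℝ → ℝ} (h : NConvexOn 3 a b f) :
    ∃ f₁ f₂ : ℝ → ℝ, (∀ x ∈ Ioo a b, HasDerivAt f (f₁ x) x) ∧
      (∀ x ∈ Ioo a b, HasDerivAt f₁ (f₂ x) x) ∧ ConvexOn ℝ (Ioo a b) f₂ := by
  obtain ⟨hc, hconv⟩ := h
  have hu : UniqueDiffOn ℝ (Ioo a b) := isOpen_Ioo.uniqueDiffOn
  have hc : ContDiffOn ℝ 2 f (Ioo a b) := by exact_mod_cast hc
  refine ⟨iteratedDerivWithin 1 f (Ioo a b), iteratedDerivWithin 2 f (Ioo a b), ?_, ?_, hconv⟩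
  · intro x hx
    rw [iteratedDerivWithin_one]
    exact ((hc.differentiableOn (by norm_num)) x hx).hasDerivWithinAt.hasDerivAt
      (isOpen_Ioo.mem_nhds hx)
  · intro x hx
    rw [iteratedDerivWithin_succ (n := 1)]
    exact ((hc.differentiableOn_iteratedDerivWithin (m := 1) (by norm_num) hu) x
      hx).hasDerivWithinAt.hasDerivAt (isOpen_Ioo.mem_nhds hx)

lemma integral_muX (f : ℝ → ℝ) :
    ∫ x, f x ∂muX = (f (-(√2 / 2)) + f 0 + f (√2 / 2)) / 3 := by
  have hi : ∀ c : ℝ, Integrable f (Measure.dirac c) := fun c =>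
    integrable_dirac (by simp)
  rw [muX, integral_smul_measure, integral_add_measure ((hi _).add_measure (hi _)) (hi _),
    integral_add_measure (hi _) (hi _)]
  simp only [integral_dirac, ENNReal.toReal_inv, ENNReal.toReal_ofNat, smul_eq_mul]
  ring

lemma integral_muY (f : ℝ → ℝ) :
    ∫ x, f x ∂muY = (f (-1) + f 1) / 12 + 5 / 12 * (f (-(√5 / 5)) + f (√5 / 5)) := by
  have hi : ∀ c : ℝ, Integrable f (Measure.dirac c) := fun c =>
    integrable_dirac (by simp)
  rw [muY, integral_add_measure, integral_smul_measure, integral_smul_measure,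
    integral_add_measure (hi _) (hi _), integral_add_measure (hi _) (hi _)]
  · simp only [integral_dirac, ENNReal.toReal_inv, ENNReal.toReal_div, ENNReal.toReal_ofNat,
      smul_eq_mul]
    ring
  · exact ((hi _).add_measure (hi _)).smul_measure (by simp)
  · exact ((hi _).add_measure (hi _)).smul_measure (ENNReal.div_ne_top (by simp) (by simp))

/-- **The 4-convex ordering (w4): `X ≤_{4-cx} Y`.** For every continuous 3-convex
function `f : [−1,1] → ℝ`, `E[f(X)] = ∫ f dμ_X ≤ ∫ f dμ_Y = E[f(Y)]`. -/
theorem statement14 (f : ℝ → ℝ)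
    (hf : ContinuousOn f (Icc (-1 : ℝ) 1))
    (hconv : NConvexOn 3 (-1 : ℝ) 1 f) :
    (∫ x, f x ∂muX) ≤ ∫ x, f x ∂muY := by
  rw [integral_muX, integral_muY]
  obtain ⟨f₁, f₂, hf₁, hf₂, hφ⟩ := hconv.exists_hasDerivAt
  have h2 : √2 ^ 2 = 2 := Real.sq_sqrt (by norm_num)
  have h5 : √5 ^ 2 = 5 := Real.sq_sqrt (by norm_num)
  have h2' : √2 ≤ 1.42 := Real.sqrt_le_iff.mpr (by norm_num)
  have h5' : 2.2 ≤ √5 := Real.le_sqrt_of_sq_le (by norm_num)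
  have h5'' : √5 ≤ 3 := Real.sqrt_le_iff.mpr (by norm_num)
  obtain ⟨a, ha⟩ : ∃ a, a = √2 / 2 := ⟨_, rfl⟩
  obtain ⟨b, hb⟩ : ∃ b, b = √5 / 5 := ⟨_, rfl⟩
  rw [← ha, ← hb]
  have ha0 : 0 ≤ a := by rw [ha]; positivity
  have hb0 : 0 ≤ b := by rw [hb]; positivity
  have ha1 : a ≤ 1 := by linarith
  have hb1 : b ≤ 1 := by linarith
  have hab : a ≤ (1 + b) / 2 := by linarith
  have ha2 : a ^ 2 = 1 / 2 := by rw [ha, div_pow, h2]; norm_num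
  have hb2 : b ^ 2 = 1 / 5 := by rw [hb, div_pow, h5]; norm_num
  have abs_mul_le : ∀ c t : ℝ, |c| ≤ 1 → |c * t| ≤ |t| := fun c t hc => by
    rw [abs_mul]; exact mul_le_of_le_one_left (abs_nonneg t) hc
  have cont : ∀ c : ℝ, |c| ≤ 1 → ContinuousOn (fun t => f (c * t)) (Icc (-1 : ℝ) 1) :=
    fun c hc => hf.comp (by fun_prop) fun t ht =>
      abs_le.mp ((abs_mul_le c t hc).trans (abs_le.mpr ht))
  have scale : ∀ {g g' : ℝ → ℝ}, (∀ x ∈ Ioo (-1 : ℝ) 1, HasDerivAt g (g' x) x) →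
      ∀ c : ℝ, |c| ≤ 1 → ∀ t ∈ Ioo (-1 : ℝ) 1,
        HasDerivAt (fun t => g (c * t)) (g' (c * t) * c) t := by
    intro g g' hg c hc t ht
    have hmul : HasDerivAt (fun t => c * t) c t := by
      simpa using (hasDerivAt_id t).const_mul c
    exact (hg (c * t) (abs_lt.mp ((abs_mul_le c t hc).trans_lt (abs_lt.mpr ht)))).comp t hmul
  have c1 : |(1 : ℝ)| ≤ 1 := by simp
  have c1' : |(-1 : ℝ)| ≤ 1 := by simp
  have ca : |a| ≤ 1 := by rwa [abs_of_nonneg ha0]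
  have ca' : |-a| ≤ 1 := by rwa [abs_neg]
  have cb : |b| ≤ 1 := by rwa [abs_of_nonneg hb0]
  have cb' : |-b| ≤ 1 := by rwa [abs_neg]
  -- the defect of the inequality for the rescaled function `x ↦ f (t x)` is convex in `t`
  have hH : ConvexOn ℝ (Icc (-1 : ℝ) 1) fun t =>
      1 / 12 * (f (1 * t) + f (-1 * t)) + 5 / 12 * (f (b * t) + f (-b * t))
        - 1 / 3 * (f (a * t) + f (-a * t)) := by
    refine convexOn_of_hasDerivWithinAt2_nonneg (convex_Icc _ _)
      (f' := fun t => 1 / 12 * (f₁ (1 * t) * 1 + f₁ (-1 * t) * -1)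
        + 5 / 12 * (f₁ (b * t) * b + f₁ (-b * t) * -b)
        - 1 / 3 * (f₁ (a * t) * a + f₁ (-a * t) * -a))
      (f'' := fun t => 1 / 12 * (f₂ (1 * t) * 1 * 1 + f₂ (-1 * t) * -1 * -1)
        + 5 / 12 * (f₂ (b * t) * b * b + f₂ (-b * t) * -b * -b)
        - 1 / 3 * (f₂ (a * t) * a * a + f₂ (-a * t) * -a * -a)) ?_ ?_ ?_ ?_
    · exact ((((cont 1 c1).add (cont (-1) c1')).const_mul _).add
        (((cont b cb).add (cont (-b) cb')).const_mul _)).sub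
        (((cont a ca).add (cont (-a) ca')).const_mul _)
    · intro t ht
      rw [interior_Icc] at ht
      have d := fun c hc => scale hf₁ c hc t ht
      exact (((((d 1 c1).add (d (-1) c1')).const_mul _).add
        (((d b cb).add (d (-b) cb')).const_mul _)).sub
        (((d a ca).add (d (-a) ca')).const_mul _)).hasDerivWithinAt
    · intro t ht
      rw [interior_Icc] at ht
      have d := fun c hc => (scale hf₂ c hc t ht).mul_const c
      exact (((((d 1 c1).add (d (-1) c1')).const_mul _).add
        (((d b cb).add (d (-b) cb')).const_mul _)).sub
        (((d a ca).add (d (-a) ca')).const_mul _)).hasDerivWithinAt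
    · intro t ht
      rw [interior_Icc] at ht
      have key := hφ.two_mul_add_neg_le ha0 hb0 hb1 hab ht
      simp only [neg_mul, one_mul]
      have eb : f₂ (b * t) * b * b + f₂ (-(b * t)) * -b * -b
          = 1 / 5 * (f₂ (b * t) + f₂ (-(b * t))) := by rw [← hb2]; ring
      have ea : f₂ (a * t) * a * a + f₂ (-(a * t)) * -a * -a
          = 1 / 2 * (f₂ (a * t) + f₂ (-(a * t))) := by rw [← ha2]; ring
      rw [ea, eb]
      linarith
  have h := hH.2 (left_mem_Icc.mpr (by norm_num)) (right_mem_Icc.mpr (by norm_num))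
    (half_pos one_pos).le (half_pos one_pos).le (add_halves 1)
  norm_num at h
  linarith
end
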